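/- arXiv:1910.01095 — 3 statements merged into one kernel-verified Lean document; each statement's English description precedes it below -/
import Mathlib

section
/- Let λ=(λ_1,…,λ_m) be an m-partition of n, let d ≥ 1 be an integer, and let U_i ⊂ ℂ^{λ_i} be finite sets with |U_i| > d^{λ_i} for each i ∈ [m]. If a polynomial p ∈ ℂ[x_1,…,x_n] of degree d vanishes on the entire product U_1 × U_2 × … × U_m, then p is λ-reducible; that is, there exist positive dimensional varieties C_i ⊆ ℂ^{λ_i} with C_1 × C_2 × … × C_m ⊆ Z(p). -/
/-- A subset of `ℂ^σ` is Zariski closed if it is the common zero set of a family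
of polynomials. -/
def IsZariskiClosed {σ : Type*} (V : Set (σ → ℂ)) : Prop :=
  ∃ T : Set (MvPolynomial σ ℂ), V = {x | ∀ f ∈ T, MvPolynomial.eval x f = 0}

theorem Polynomial.height_ker_eq_add_one {R L : Type*} [CommRing R] [IsNoetherianRing R] [Field L]
    (φ : Polynomial R →+* L) (hφ : Function.Surjective (φ.comp Polynomial.C)) :
    (RingHom.ker φ).height = (RingHom.ker (φ.comp Polynomial.C)).height + 1 := by
  have : (RingHom.ker φ).IsMaximal :=
    RingHom.ker_isMaximal_of_surjective φ (Function.Surjective.of_comp hφ)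
  have : (RingHom.ker φ).LiesOver (RingHom.ker (φ.comp Polynomial.C)) := ⟨rfl⟩
  exact Polynomial.height_eq_height_add_one _ _

theorem MvPolynomial.height_ker_eq_add {R L : Type*} [CommRing R] [IsNoetherianRing R] [Field L]
    (n : ℕ) (φ : MvPolynomial (Fin n) R →+* L)
    (hφ : Function.Surjective (φ.comp MvPolynomial.C)) :
    (RingHom.ker φ).height = (RingHom.ker (φ.comp MvPolynomial.C)).height + n := by
  induction n with
  | zero =>
    rw [← RingEquiv.height_comap (MvPolynomial.isEmptyRingEquiv R (Fin 0)).symm (RingHom.ker φ)]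
    have h : (RingHom.ker φ).comap (MvPolynomial.isEmptyRingEquiv R (Fin 0)).symm =
        RingHom.ker (φ.comp MvPolynomial.C) := rfl
    simp [h]
  | succ n ih =>
    let e := (MvPolynomial.finSuccEquiv R n).symm.toRingEquiv
    let ψ : Polynomial (MvPolynomial (Fin n) R) →+* L := φ.comp e.toRingHom
    have hC : (ψ.comp Polynomial.C).comp MvPolynomial.C = φ.comp MvPolynomial.C := by
      ext a
      have : (MvPolynomial.finSuccEquiv R n).symm (Polynomial.C (MvPolynomial.C a)) =
          MvPolynomial.C a := by
        rw [AlgEquiv.symm_apply_eq]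
        simp [MvPolynomial.finSuccEquiv_apply]
      exact congrArg φ this
    have h1 := ih (ψ.comp Polynomial.C) (by rwa [hC])
    have h2 := Polynomial.height_ker_eq_add_one ψ
      (Function.Surjective.of_comp (g := MvPolynomial.C) (by
        have := hφ
        rw [← hC] at this
        exact this))
    have h3 : RingHom.ker ψ = (RingHom.ker φ).comap e := rfl
    rw [← RingEquiv.height_comap e, ← h3, h2, h1, hC]
    push_cast
    rw [add_assoc]

theorem MvPolynomial.eq_ker_eval_of_finite_zeros {K σ : Type*} [Field K] [IsAlgClosed K] [Finite σ]
    (P : Ideal (MvPolynomial σ K)) [P.IsPrime]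
    (hfin : {x : σ → K | ∀ f ∈ P, MvPolynomial.eval x f = 0}.Finite)
    (z : σ → K) (hz : P ≤ RingHom.ker (MvPolynomial.eval z)) :
    P = RingHom.ker (MvPolynomial.eval z) := by
  have hle : hfin.toFinset.inf (fun x => RingHom.ker (MvPolynomial.eval x)) ≤ P := by
    intro f hf
    rw [← MvPolynomial.IsPrime.vanishingIdeal_zeroLocus (K := K) P]
    intro x hx
    have hx' : x ∈ hfin.toFinset := by simpa [MvPolynomial.aeval_eq_eval] using hx
    have := Finset.inf_le (f := fun x => RingHom.ker (MvPolynomial.eval x)) hx' hf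
    simpa [MvPolynomial.aeval_eq_eval] using this
  obtain ⟨x, -, hx⟩ := (Ideal.IsPrime.inf_le' ‹_›).1 hle
  have hmax : (RingHom.ker (MvPolynomial.eval x)).IsMaximal :=
    RingHom.ker_isMaximal_of_surjective _ fun a => ⟨MvPolynomial.C a, by simp⟩
  have := hmax.eq_of_le (RingHom.ker_ne_top _) (hx.trans hz)
  exact le_antisymm hz (this ▸ hx)

theorem Submodule.exists_mem_forall_notMem {K V : Type*} [Field K] [Infinite K] [AddCommGroup V]
    [Module K V] (W : Submodule K V) (S : Set (Submodule K V)) (hS : S.Finite)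
    (h : ∀ P ∈ S, ¬ W ≤ P) : ∃ f ∈ W, ∀ P ∈ S, f ∉ P := by
  classical
  have hn : ⊤ ∉ hS.toFinset.image (fun P => P.comap W.subtype) := by
    simp only [Finset.mem_image, Set.Finite.mem_toFinset, not_exists, not_and]
    intro P hP htop
    exact h P hP (by simpa [Submodule.comap_subtype_eq_top] using htop)
  have := Subspace.biUnion_ne_univ_of_top_notMem hn
  obtain ⟨f, hf⟩ := (Set.ne_univ_iff_exists_notMem _).1 this
  refine ⟨f, f.2, fun P hP hfP => hf ?_⟩
  simp only [Finset.mem_image, Set.Finite.mem_toFinset, Set.mem_iUnion]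
  exact ⟨_, ⟨P, hP, rfl⟩, hfP⟩

theorem MvPolynomial.height_ker_eval {K : Type*} [Field K] (k : ℕ) (z : Fin k → K) :
    (RingHom.ker (MvPolynomial.eval z)).height = k := by
  have hid : (MvPolynomial.eval z).comp MvPolynomial.C = RingHom.id K := by ext; simp
  rw [MvPolynomial.height_ker_eq_add k _ (by rw [hid]; exact Function.surjective_id), hid]
  have : RingHom.ker (RingHom.id K) = ⊥ := by ext; simp
  simp [this]

theorem MvPolynomial.exists_family_height_ge {K : Type*} [Field K] [IsAlgClosed K] (k : ℕ)
    (W : Submodule K (MvPolynomial (Fin k) K))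
    (hfin : {x : Fin k → K | ∀ f ∈ W, MvPolynomial.eval x f = 0}.Finite) (j : ℕ) (hj : j ≤ k) :
    ∃ f : Fin j → MvPolynomial (Fin k) K, (∀ i, f i ∈ W) ∧
      ∀ z : Fin k → K, (∀ f ∈ W, MvPolynomial.eval z f = 0) →
        ∀ P : Ideal (MvPolynomial (Fin k) K), P.IsPrime →
          P ≤ RingHom.ker (MvPolynomial.eval z) → (∀ i, f i ∈ P) → (j : ℕ∞) ≤ P.height := by
  induction j with
  | zero => exact ⟨Fin.elim0, fun i => i.elim0, by simp⟩
  | succ j ih =>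
    obtain ⟨f, hfW, hf⟩ := ih (by omega)
    have : Infinite K := IsAlgClosed.instInfinite
    let I := Ideal.span (Set.range f)
    have hI : I.minimalPrimes.Finite := Ideal.finite_minimalPrimes_of_isNoetherianRing _ I
    obtain ⟨g, hgW, hg⟩ := Submodule.exists_mem_forall_notMem W
      (Submodule.restrictScalars K '' {P ∈ I.minimalPrimes | ¬ W ≤ P.restrictScalars K})
      ((hI.subset (Set.sep_subset _ _)).image _) (by rintro _ ⟨P, hP, rfl⟩; exact hP.2)
    refine ⟨Fin.snoc f g, fun i => ?_, fun z hz P hP hPz hfP => ?_⟩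
    · induction i using Fin.lastCases <;> simp [hgW, hfW]
    have hgP : g ∈ P := by simpa using hfP (Fin.last j)
    have hfP' : ∀ i, f i ∈ P := fun i => by simpa using hfP i.castSucc
    have hIP : I ≤ P := Ideal.span_le.2 (by rintro _ ⟨i, rfl⟩; exact hfP' i)
    obtain ⟨Q, hQ, hQP⟩ := Ideal.exists_minimalPrimes_le hIP
    have hQprime : Q.IsPrime := hQ.1.1
    by_cases hWQ : W ≤ Q.restrictScalars K
    · have hQz : Q = RingHom.ker (MvPolynomial.eval z) := by
        refine MvPolynomial.eq_ker_eval_of_finite_zeros Q (hfin.subset ?_) z (hQP.trans hPz)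
        exact fun x hx f hf => hx f (hWQ hf)
      have : P = RingHom.ker (MvPolynomial.eval z) := le_antisymm hPz (hQz ▸ hQP)
      rw [this, MvPolynomial.height_ker_eval]
      exact_mod_cast hj
    · have hgQ : g ∉ Q := hg _ ⟨Q, ⟨hQ, hWQ⟩, rfl⟩
      have hlt : Q < P := lt_of_le_of_ne hQP (fun h => hgQ (h ▸ hgP))
      have h1 := Ideal.height_add_one_le_of_lt_of_isPrime hlt
      have h2 := hf z hz Q hQprime (hQP.trans hPz)
        fun i => hQ.1.2 (Ideal.subset_span ⟨i, rfl⟩)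
      push_cast
      exact (add_le_add_left h2 1).trans h1

open Classical in
/-- Send a monomial `x ^ α` with some `d ≤ α i` to `x ^ (α - d e_i) * f i`, and all other monomials
to zero. -/
noncomputable def MvPolynomial.reductionMap {K σ : Type*} [Field K] (d : ℕ)
    (f : σ → MvPolynomial σ K) : MvPolynomial σ K →ₗ[K] MvPolynomial σ K :=
  (MvPolynomial.basisMonomials σ K).constr K fun α =>
    if h : ∃ i, d ≤ α i then
      MvPolynomial.monomial (α - Finsupp.single h.choose d) 1 * f h.choose else 0

theorem MvPolynomial.reductionMap_mem_restrictTotalDegree {K σ : Type*} [Field K] {d : ℕ}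
    {f : σ → MvPolynomial σ K} (hf : ∀ i, (f i).totalDegree ≤ d) (D : ℕ) :
    ∀ v ∈ MvPolynomial.restrictTotalDegree σ K D,
      MvPolynomial.reductionMap d f v ∈ MvPolynomial.restrictTotalDegree σ K D := by
  suffices h : MvPolynomial.restrictTotalDegree σ K D ≤
      (MvPolynomial.restrictTotalDegree σ K D).comap (MvPolynomial.reductionMap d f) from h
  conv_lhs => rw [MvPolynomial.restrictTotalDegree, MvPolynomial.restrictSupport_eq_span]
  rw [Submodule.span_le]
  rintro _ ⟨α, hα, rfl⟩
  have hα' : α.degree ≤ D := hα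
  have hb : MvPolynomial.reductionMap d f (MvPolynomial.monomial α 1) = _ :=
    (MvPolynomial.basisMonomials σ K).constr_basis K _ α
  rw [SetLike.mem_coe, Submodule.mem_comap, MvPolynomial.mem_restrictTotalDegree, hb]
  split_ifs with h
  · refine (MvPolynomial.totalDegree_mul _ _).trans ?_
    rw [MvPolynomial.totalDegree_monomial _ one_ne_zero]
    have hle : Finsupp.single h.choose d ≤ α := by
      rw [Finsupp.single_le_iff]; exact h.choose_spec
    have hdeg : (α - Finsupp.single h.choose d).degree + d = α.degree := by
      conv_rhs => rw [← tsub_add_cancel_of_le hle]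
      simp
    have h1 : ((α - Finsupp.single h.choose d).sum fun _ e => e) =
      (α - Finsupp.single h.choose d).degree := rfl
    have := hf h.choose
    omega
  · simp

/-- The `K[t]`-submodule of `K[t][x]` generated by `J` and the monomials of degree less than `d` in
each variable. -/
noncomputable def MvPolynomial.reducedSpan {K : Type*} [Field K] (k d : ℕ)
    (J : Ideal (MvPolynomial (Fin k) (Polynomial K))) :
    Submodule (Polynomial K) (MvPolynomial (Fin k) (Polynomial K)) :=
  J.restrictScalars (Polynomial K) ⊔ Submodule.span (Polynomial K)
    (Set.range fun α : Fin k → Fin d =>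
      MvPolynomial.monomial (Finsupp.equivFunOnFinite.symm fun i => (α i : ℕ)) 1)

theorem MvPolynomial.X_smul_add_reductionMap_mem {K : Type*} [Field K] {k d : ℕ}
    {f : Fin k → MvPolynomial (Fin k) K} {J : Ideal (MvPolynomial (Fin k) (Polynomial K))}
    (hJ : ∀ i, MvPolynomial.C Polynomial.X * MvPolynomial.X i ^ d +
      MvPolynomial.map Polynomial.C (f i) ∈ J) (v : MvPolynomial (Fin k) K) :
    (Polynomial.X : Polynomial K) • MvPolynomial.map Polynomial.C v +
      MvPolynomial.map Polynomial.C (MvPolynomial.reductionMap d f v) ∈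
        MvPolynomial.reducedSpan k d J := by
  induction v using MvPolynomial.induction_on' with
  | add p q hp hq =>
    convert Submodule.add_mem _ hp hq using 1
    simp only [map_add, smul_add]
    ring
  | monomial α a =>
    suffices h : (Polynomial.X : Polynomial K) • MvPolynomial.map Polynomial.C
        (MvPolynomial.monomial α (1 : K)) + MvPolynomial.map Polynomial.C
          (MvPolynomial.reductionMap d f (MvPolynomial.monomial α 1)) ∈
          MvPolynomial.reducedSpan k d J by
      have ha : MvPolynomial.monomial α a = a • MvPolynomial.monomial α (1 : K) := by
        rw [MvPolynomial.smul_monomial, smul_eq_mul, mul_one]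
      have := Submodule.smul_mem _ (Polynomial.C a) h
      rw [ha, LinearMap.map_smul]
      convert this using 1
      simp only [MvPolynomial.smul_eq_C_mul, map_mul, MvPolynomial.map_C, mul_add]
      ring
    have hb : MvPolynomial.reductionMap d f (MvPolynomial.monomial α 1) = _ :=
      (MvPolynomial.basisMonomials (Fin k) K).constr_basis K _ α
    rw [hb]
    split_ifs with h
    · refine Submodule.mem_sup_left ?_
      have hle : Finsupp.single h.choose d ≤ α := by
        rw [Finsupp.single_le_iff]; exact h.choose_spec
      have hmon : MvPolynomial.monomial α (1 : K) =
          MvPolynomial.monomial (α - Finsupp.single h.choose d) 1 *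
            MvPolynomial.X h.choose ^ d := by
        rw [MvPolynomial.X_pow_eq_monomial, MvPolynomial.monomial_mul, tsub_add_cancel_of_le hle,
          one_mul]
      rw [Submodule.restrictScalars_mem]
      convert J.mul_mem_left (MvPolynomial.map Polynomial.C
        (MvPolynomial.monomial (α - Finsupp.single h.choose d) 1)) (hJ h.choose) using 1
      rw [hmon, MvPolynomial.smul_eq_C_mul]
      simp only [map_mul, map_pow, MvPolynomial.map_X]
      ring
    · push Not at h
      refine Submodule.mem_sup_right ?_
      rw [map_zero, add_zero, MvPolynomial.map_monomial, map_one]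
      refine Submodule.smul_mem _ _ (Submodule.subset_span ⟨fun i => ⟨α i, h i⟩, ?_⟩)
      exact congrArg (fun β => MvPolynomial.monomial β 1) (Finsupp.ext fun i => rfl)

theorem MvPolynomial.exists_smul_mem_reducedSpan {K : Type*} [Field K] {k d : ℕ}
    {f : Fin k → MvPolynomial (Fin k) K} (hf : ∀ i, (f i).totalDegree ≤ d)
    {J : Ideal (MvPolynomial (Fin k) (Polynomial K))}
    (hJ : ∀ i, MvPolynomial.C Polynomial.X * MvPolynomial.X i ^ d +
      MvPolynomial.map Polynomial.C (f i) ∈ J) (g : MvPolynomial (Fin k) K) :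
    ∃ q : Polynomial K, q ≠ 0 ∧
      q • MvPolynomial.map Polynomial.C g ∈ MvPolynomial.reducedSpan k d J := by
  set V := MvPolynomial.restrictTotalDegree (Fin k) K g.totalDegree with hV
  have hfinite : {n : Fin k →₀ ℕ | (n.sum fun _ e => e) ≤ g.totalDegree}.Finite :=
    Finsupp.finite_of_degree_le _
  have : Finite {n : Fin k →₀ ℕ | (n.sum fun _ e => e) ≤ g.totalDegree} := hfinite
  have : Module.Finite K V := Module.Finite.of_basis (MvPolynomial.basisRestrictSupport K _)
  let B : Module.End K V := -((MvPolynomial.reductionMap d f).restrict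
    (MvPolynomial.reductionMap_mem_restrictTotalDegree hf g.totalDegree))
  have key : ∀ (q : Polynomial K) (v : V),
      q • MvPolynomial.map Polynomial.C (v : MvPolynomial (Fin k) K) -
        MvPolynomial.map Polynomial.C ((Polynomial.aeval B q v : V) : MvPolynomial (Fin k) K) ∈
        MvPolynomial.reducedSpan k d J := by
    intro q
    induction q using Polynomial.induction_on with
    | C a =>
      intro v
      simp [MvPolynomial.smul_eq_C_mul]
    | add p q hp hq =>
      intro v
      convert Submodule.add_mem _ (hp v) (hq v) using 1
      simp only [map_add, LinearMap.add_apply, Submodule.coe_add, add_smul]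
      ring
    | monomial n a h =>
      intro v
      have h1 := Submodule.smul_mem _ (Polynomial.C a * Polynomial.X ^ n)
        (MvPolynomial.X_smul_add_reductionMap_mem hJ (v : MvPolynomial (Fin k) K))
      convert Submodule.add_mem _ h1 (h (B v)) using 1
      have h2 : ((B v : V) : MvPolynomial (Fin k) K) = -MvPolynomial.reductionMap d f v := rfl
      rw [h2, pow_succ, ← mul_assoc, map_mul, Polynomial.aeval_X, Module.End.mul_apply, smul_add,
        mul_smul, map_neg, smul_neg]
      ring
  refine ⟨B.charpoly, B.charpoly_monic.ne_zero, ?_⟩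
  have := key B.charpoly ⟨g, by rw [hV, MvPolynomial.mem_restrictTotalDegree]⟩
  simpa [LinearMap.aeval_self_charpoly] using this

theorem LinearIndependent.card_le_of_smul_mem_span {A M ι κ : Type*} [CommRing A] [IsDomain A]
    [AddCommGroup M] [Module A M] [Fintype ι] [Fintype κ] {v : ι → M} (hv : LinearIndependent A v)
    (w : κ → M) (h : ∀ i, ∃ q : A, q ≠ 0 ∧ q • v i ∈ Submodule.span A (Set.range w)) :
    Fintype.card ι ≤ Fintype.card κ := by
  classical
  choose q hq hqv using h
  have hli : LinearIndependent A fun i => q i • v i := by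
    rw [Fintype.linearIndependent_iff] at hv ⊢
    intro c hc i
    simp only [smul_smul] at hc
    exact (mul_eq_zero.1 (hv _ hc i)).resolve_right (hq i)
  have h1 := linearIndependent_le_span_aux' _ hli (Set.range w) (by rintro _ ⟨i, rfl⟩; exact hqv i)
  exact h1.trans (Fintype.card_range_le w)

theorem MvPolynomial.card_le_pow_of_independent {K : Type*} [Field K] {k d : ℕ}
    {f : Fin k → MvPolynomial (Fin k) K} (hf : ∀ i, (f i).totalDegree ≤ d)
    {J : Ideal (MvPolynomial (Fin k) (Polynomial K))}
    (hJ : ∀ i, MvPolynomial.C Polynomial.X * MvPolynomial.X i ^ d +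
      MvPolynomial.map Polynomial.C (f i) ∈ J)
    {ι : Type*} [Fintype ι] (g : ι → MvPolynomial (Fin k) K)
    (hg : ∀ c : ι → Polynomial K, ∑ i, c i • MvPolynomial.map Polynomial.C (g i) ∈ J → c = 0) :
    Fintype.card ι ≤ d ^ k := by
  have hli : LinearIndependent (Polynomial K) fun i =>
      (J.restrictScalars (Polynomial K)).mkQ (MvPolynomial.map Polynomial.C (g i)) := by
    rw [Fintype.linearIndependent_iff]
    intro c hc
    simp only [← map_smul, ← map_sum] at hc
    exact congrFun (hg c ((Submodule.Quotient.mk_eq_zero _).1 hc))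
  have hcard := hli.card_le_of_smul_mem_span (fun α : Fin k → Fin d =>
    (J.restrictScalars (Polynomial K)).mkQ
      (MvPolynomial.monomial (Finsupp.equivFunOnFinite.symm fun i => (α i : ℕ)) 1)) fun i => by
    obtain ⟨q, hq, hqg⟩ := MvPolynomial.exists_smul_mem_reducedSpan hf hJ (g i)
    refine ⟨q, hq, ?_⟩
    have := Submodule.mem_map_of_mem (f := (J.restrictScalars (Polynomial K)).mkQ) hqg
    rwa [MvPolynomial.reducedSpan, Submodule.map_sup, Submodule.map_span, Submodule.mkQ_map_self,
      bot_sup_eq, ← Set.range_comp, map_smul] at this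
  rwa [Fintype.card_fun, Fintype.card_fin, Fintype.card_fin] at hcard

theorem MvPolynomial.height_ker_eval_comp_map_eval_zero {K : Type*} [Field K] (k : ℕ)
    (z : Fin k → K) :
    (RingHom.ker ((MvPolynomial.eval z).comp
      (MvPolynomial.map (Polynomial.evalRingHom (0 : K))))).height = 1 + k := by
  have h : ((MvPolynomial.eval z).comp
      (MvPolynomial.map (Polynomial.evalRingHom (0 : K)))).comp MvPolynomial.C =
      Polynomial.evalRingHom 0 := by
    ext <;> simp
  have hid : (Polynomial.evalRingHom (0 : K)).comp Polynomial.C = RingHom.id K := by ext; simp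
  have hsurj : Function.Surjective ((Polynomial.evalRingHom (0 : K)).comp Polynomial.C) := by
    rw [hid]; exact Function.surjective_id
  have hker : RingHom.ker (RingHom.id K) = ⊥ := by ext; simp
  rw [MvPolynomial.height_ker_eq_add k _ (by rw [h]; exact Function.Surjective.of_comp hsurj), h,
    Polynomial.height_ker_eq_add_one _ hsurj, hid, hker]
  simp

theorem MvPolynomial.exists_deformation_prime {K : Type*} [Field K] {k d : ℕ}
    (f : Fin k → MvPolynomial (Fin k) K) (z : Fin k → K) (hz : ∀ i, MvPolynomial.eval z (f i) = 0)
    (hf : ∀ P : Ideal (MvPolynomial (Fin k) K), P.IsPrime →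
      P ≤ RingHom.ker (MvPolynomial.eval z) → (∀ i, f i ∈ P) → (k : ℕ∞) ≤ P.height) :
    ∃ P : Ideal (MvPolynomial (Fin k) (Polynomial K)), P.IsPrime ∧
      (∀ i, MvPolynomial.C Polynomial.X * MvPolynomial.X i ^ d +
        MvPolynomial.map Polynomial.C (f i) ∈ P) ∧
      MvPolynomial.C Polynomial.X ∉ P ∧
      P ≤ RingHom.ker ((MvPolynomial.eval z).comp
        (MvPolynomial.map (Polynomial.evalRingHom (0 : K)))) := by
  set φ := (MvPolynomial.eval z).comp (MvPolynomial.map (Polynomial.evalRingHom (0 : K))) with hφ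
  let F : Fin k → MvPolynomial (Fin k) (Polynomial K) := fun i =>
    MvPolynomial.C Polynomial.X * MvPolynomial.X i ^ d + MvPolynomial.map Polynomial.C (f i)
  have hcomp : (MvPolynomial.map (σ := Fin k) (Polynomial.evalRingHom (0 : K))).comp
      (MvPolynomial.map Polynomial.C) = RingHom.id _ := by
    ext <;> simp
  have hcomp' : ∀ g, MvPolynomial.map (σ := Fin k) (Polynomial.evalRingHom (0 : K))
      (MvPolynomial.map Polynomial.C g) = g := fun g => DFunLike.congr_fun hcomp g
  have hF : Ideal.span (Set.range F) ≤ RingHom.ker φ := by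
    rw [Ideal.span_le]
    rintro _ ⟨i, rfl⟩
    simp [F, hφ, hcomp', hz, RingHom.mem_ker]
  have hkerφ : (RingHom.ker φ).IsPrime := RingHom.ker_isPrime _
  obtain ⟨P, hP, hPφ⟩ := Ideal.exists_minimalPrimes_le hF
  have hprime : P.IsPrime := hP.1.1
  have hFP : ∀ i, F i ∈ P := fun i => hP.1.2 (Ideal.subset_span ⟨i, rfl⟩)
  refine ⟨P, hprime, hFP, fun hX => ?_, hPφ⟩
  have hfP : ∀ i, f i ∈ P.comap (MvPolynomial.map Polynomial.C) := fun i =>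
    (P.add_mem_iff_right (P.mul_mem_right _ hX)).1 (hFP i)
  have hle : P.comap (MvPolynomial.map Polynomial.C) ≤ RingHom.ker (MvPolynomial.eval z) := by
    intro g hg
    have : φ (MvPolynomial.map Polynomial.C g) = 0 := hPφ hg
    simpa [hφ, hcomp'] using this
  have hQ : (P.comap (MvPolynomial.map Polynomial.C)).IsPrime := inferInstance
  have hheight := hf _ hQ hle hfP
  have heq : P.comap (MvPolynomial.map Polynomial.C) = RingHom.ker (MvPolynomial.eval z) := by
    by_contra hne
    have hker : (RingHom.ker (MvPolynomial.eval z)).IsPrime := RingHom.ker_isPrime _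
    have := Ideal.height_add_one_le_of_lt_of_isPrime (lt_of_le_of_ne hle hne)
    rw [MvPolynomial.height_ker_eval] at this
    have h2 := (add_le_add_left hheight 1).trans this
    norm_cast at h2
    omega
  have hmk : (Ideal.Quotient.mk P).comp ((MvPolynomial.map Polynomial.C).comp
      (MvPolynomial.map (Polynomial.evalRingHom (0 : K)))) = Ideal.Quotient.mk P := by
    refine MvPolynomial.ringHom_ext (fun a => ?_) (fun i => by simp)
    simp only [RingHom.comp_apply, MvPolynomial.map_C]
    rw [Ideal.Quotient.mk_eq_mk_iff_sub_mem, ← map_sub]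
    obtain ⟨b, hb⟩ : Polynomial.X ∣
        Polynomial.C (Polynomial.evalRingHom (0 : K) a) - a := by
      rw [Polynomial.X_dvd_iff]
      simp [Polynomial.coeff_zero_eq_eval_zero]
    rw [hb, map_mul]
    exact P.mul_mem_right _ hX
  have hge : RingHom.ker φ ≤ P := by
    intro g hg
    have : MvPolynomial.map (Polynomial.evalRingHom (0 : K)) g ∈
        P.comap (MvPolynomial.map Polynomial.C) := heq ▸ hg
    rw [← Ideal.Quotient.eq_zero_iff_mem, ← hmk]
    exact Ideal.Quotient.eq_zero_iff_mem.2 this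
  have hkrull := Ideal.height_le_card_of_mem_minimalPrimes_span (Set.finite_range F) hP
  have hcard : (Set.range F).ncard ≤ k := by
    rw [← Set.image_univ]
    exact (Set.ncard_image_le Set.finite_univ).trans (by simp [Set.ncard_univ])
  rw [le_antisymm hPφ hge, MvPolynomial.height_ker_eval_comp_map_eval_zero] at hkrull
  norm_cast at hkrull
  omega

theorem MvPolynomial.exists_eval_ne_zero_of_finset {K σ : Type*} [Field K] (Z : Finset (σ → K))
    (z : σ → K) (hz : z ∉ Z) :
    ∃ g : MvPolynomial σ K, MvPolynomial.eval z g ≠ 0 ∧ ∀ y ∈ Z, MvPolynomial.eval y g = 0 := by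
  have h : ∀ y : σ → K, ∃ g : MvPolynomial σ K, MvPolynomial.eval y g = 0 ∧
      (y ∈ Z → MvPolynomial.eval z g ≠ 0) := by
    intro y
    by_cases hy : y ∈ Z
    · obtain ⟨i, hi⟩ := Function.ne_iff.1 (ne_of_mem_of_not_mem hy hz)
      exact ⟨MvPolynomial.X i - MvPolynomial.C (y i), by simp,
        fun _ => by simpa [sub_eq_zero] using hi.symm⟩
    · exact ⟨0, by simp, fun h => (hy h).elim⟩
  choose g hg hg' using h
  refine ⟨∏ y ∈ Z, g y, ?_, fun y hy => ?_⟩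
  · rw [map_prod]
    exact Finset.prod_ne_zero_iff.2 fun y hy => hg' y hy
  · rw [map_prod]
    exact Finset.prod_eq_zero hy (hg y)

/-- A form of Bézout's bound: a finite zero set of polynomials of degree at most `d` in `k`
variables has at most `d ^ k` points. -/
theorem MvPolynomial.card_zeros_le_pow {K : Type*} [Field K] [IsAlgClosed K] {k d : ℕ}
    (W : Submodule K (MvPolynomial (Fin k) K)) (hW : ∀ f ∈ W, f.totalDegree ≤ d)
    (Z : Finset (Fin k → K)) (hZ : ∀ x, x ∈ Z ↔ ∀ f ∈ W, MvPolynomial.eval x f = 0) :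
    Z.card ≤ d ^ k := by
  classical
  obtain ⟨f, hfW, hf⟩ := MvPolynomial.exists_family_height_ge k W
    (Z.finite_toSet.subset fun x hx => (hZ x).2 hx) k le_rfl
  choose P hprime hFP hXP hPle using fun z : Z => MvPolynomial.exists_deformation_prime f z
    (fun i => (hZ z).1 z.2 _ (hfW i)) (hf z ((hZ z).1 z.2))
  choose g hg hg' using fun z : Z =>
    MvPolynomial.exists_eval_ne_zero_of_finset (Z.erase z) z (Finset.notMem_erase _ _)
  have key : ∀ (n : ℕ) (c : Z → Polynomial K),
      ∑ z, c z • MvPolynomial.map Polynomial.C (g z) ∈ (⨅ z, P z) →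
        ∀ z, Polynomial.X ^ n ∣ c z := by
    intro n
    induction n with
    | zero => intro c _ z; simp
    | succ n ih =>
      intro c hc
      have hX : ∀ z, Polynomial.X ∣ c z := by
        intro z
        have h0 := hPle z (Ideal.mem_iInf.1 hc z)
        have hmap : ∀ p : MvPolynomial (Fin k) K,
            MvPolynomial.map (Polynomial.evalRingHom (0 : K))
              (MvPolynomial.map Polynomial.C p) = p := by
          intro p
          rw [MvPolynomial.map_map]
          convert MvPolynomial.map_id p
          ext; simp
        rw [RingHom.mem_ker, map_sum, Finset.sum_eq_single z] at h0
        · simp only [MvPolynomial.smul_eq_C_mul, RingHom.comp_apply, map_mul, hmap,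
            MvPolynomial.map_C, MvPolynomial.eval_C] at h0
          rw [Polynomial.X_dvd_iff, Polynomial.coeff_zero_eq_eval_zero]
          exact (mul_eq_zero.1 h0).resolve_right (hg z)
        · intro y _ hyz
          simp only [MvPolynomial.smul_eq_C_mul, RingHom.comp_apply, map_mul, hmap]
          rw [hg' y z (Finset.mem_erase.2 ⟨fun h => hyz (Subtype.ext h.symm), z.2⟩), mul_zero]
        · simp
      choose b hb using hX
      have hsum : ∑ z, c z • MvPolynomial.map Polynomial.C (g z) =
          MvPolynomial.C Polynomial.X * ∑ z, b z • MvPolynomial.map Polynomial.C (g z) := by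
        rw [← MvPolynomial.smul_eq_C_mul, Finset.smul_sum]
        exact Finset.sum_congr rfl fun z _ => by rw [smul_smul, ← hb z]
      have hbP : ∑ z, b z • MvPolynomial.map Polynomial.C (g z) ∈ (⨅ z, P z) := by
        rw [Ideal.mem_iInf] at hc ⊢
        intro z
        have := hc z
        rw [hsum] at this
        exact ((hprime z).mem_or_mem this).resolve_left (hXP z)
      intro z
      rw [hb z, pow_succ']
      exact mul_dvd_mul_left _ (ih b hbP z)
  have := MvPolynomial.card_le_pow_of_independent (fun i => hW _ (hfW i))
    (J := ⨅ z, P z) (fun i => Ideal.mem_iInf.2 fun z => hFP z i) g (by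
      intro c hc
      funext z
      by_contra hne
      have hdvd := key ((c z).natDegree + 1) c hc z
      have := Polynomial.natDegree_le_of_dvd hdvd hne
      rw [Polynomial.natDegree_X_pow] at this
      omega)
  simpa using this

theorem MvPolynomial.infinite_zeros_of_pow_lt_card {K : Type*} [Field K] [IsAlgClosed K] {k d : ℕ}
    (T : Set (MvPolynomial (Fin k) K)) (hT : ∀ f ∈ T, f.totalDegree ≤ d)
    (U : Finset (Fin k → K)) (hU : d ^ k < U.card)
    (hvan : ∀ x ∈ U, ∀ f ∈ T, MvPolynomial.eval x f = 0) :
    {x : Fin k → K | ∀ f ∈ T, MvPolynomial.eval x f = 0}.Infinite := by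
  intro hfin
  have hspan : ∀ x : Fin k → K, (∀ f ∈ T, MvPolynomial.eval x f = 0) →
      ∀ f ∈ Submodule.span K T, MvPolynomial.eval x f = 0 := by
    intro x hx
    have : Submodule.span K T ≤ LinearMap.ker (MvPolynomial.aeval x).toLinearMap :=
      Submodule.span_le.2 fun f hf => by simpa [MvPolynomial.aeval_eq_eval] using hx f hf
    intro f hf
    simpa [MvPolynomial.aeval_eq_eval] using this hf
  have hdeg : Submodule.span K T ≤ MvPolynomial.restrictTotalDegree (Fin k) K d :=
    Submodule.span_le.2 fun f hf => (MvPolynomial.mem_restrictTotalDegree _ _ _).2 (hT f hf)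
  have := MvPolynomial.card_zeros_le_pow (Submodule.span K T)
    (fun f hf => (MvPolynomial.mem_restrictTotalDegree _ _ _).1 (hdeg hf)) hfin.toFinset
    fun x => by
      simp only [Set.Finite.mem_toFinset, Set.mem_ofPred_eq]
      exact ⟨hspan x, fun h f hf => h f (Submodule.subset_span hf)⟩
  have hle : U.card ≤ hfin.toFinset.card :=
    Finset.card_le_card fun x hx => by simpa using hvan x hx
  omega

/-- Substitute the coordinates of `x` for all variables outside the block `i`. -/
noncomputable def MvPolynomial.restrictBlock {K ι : Type*} [Field K] [DecidableEq ι] {τ : ι → Type*}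
    (i : ι) (x : (j : ι) → τ j → K) : MvPolynomial ((j : ι) × τ j) K →ₐ[K] MvPolynomial (τ i) K :=
  MvPolynomial.aeval fun q =>
    if h : q.1 = i then MvPolynomial.X (h ▸ q.2) else MvPolynomial.C (x q.1 q.2)

theorem MvPolynomial.eval_restrictBlock {K ι : Type*} [Field K] [DecidableEq ι] {τ : ι → Type*}
    (i : ι) (x : (j : ι) → τ j → K) (y : τ i → K) (p : MvPolynomial ((j : ι) × τ j) K) :
    MvPolynomial.eval y (MvPolynomial.restrictBlock i x p) =
      MvPolynomial.eval (fun q => Function.update x i y q.1 q.2) p := by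
  have h : (MvPolynomial.eval y).comp (MvPolynomial.restrictBlock i x).toRingHom =
      MvPolynomial.eval (fun q => Function.update x i y q.1 q.2) := by
    refine MvPolynomial.ringHom_ext (fun a => ?_) ?_
    · simp [MvPolynomial.restrictBlock]
    · rintro ⟨j, s⟩
      by_cases hj : j = i
      · subst hj
        simp [MvPolynomial.restrictBlock]
      · simp [MvPolynomial.restrictBlock, hj]
  exact DFunLike.congr_fun h p

theorem MvPolynomial.totalDegree_restrictBlock_le {K ι : Type*} [Field K] [DecidableEq ι]
    {τ : ι → Type*} (i : ι) (x : (j : ι) → τ j → K) (p : MvPolynomial ((j : ι) × τ j) K) :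
    (MvPolynomial.restrictBlock i x p).totalDegree ≤ p.totalDegree := by
  rw [MvPolynomial.restrictBlock, MvPolynomial.aeval_def, MvPolynomial.eval₂_eq]
  refine MvPolynomial.totalDegree_finsetSum_le fun α hα => ?_
  refine (MvPolynomial.totalDegree_mul _ _).trans ?_
  rw [MvPolynomial.algebraMap_eq, MvPolynomial.totalDegree_C, zero_add]
  refine (MvPolynomial.totalDegree_finsetProd _ _).trans ?_
  refine le_trans (Finset.sum_le_sum fun q _ => ?_) (MvPolynomial.le_totalDegree hα)
  refine (MvPolynomial.totalDegree_pow _ _).trans ?_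
  refine (Nat.mul_le_mul_left _ (?_ : _ ≤ 1)).trans (mul_one _).le
  split_ifs <;> simp

/-- If a degree-`d` polynomial vanishes on a product of finite sets `U i` with
`|U i| > d^{λ_i}`, then it is `λ`-reducible: its zero set contains a product of
infinite Zariski closed (positive dimensional) varieties. -/
theorem stmt_8 (m : ℕ) (lam : Fin m → ℕ) (d : ℕ) (hd : 1 ≤ d)
    (U : (i : Fin m) → Finset (Fin (lam i) → ℂ)) (hU : ∀ i, d ^ lam i < (U i).card)
    (p : MvPolynomial ((i : Fin m) × Fin (lam i)) ℂ) (hp : p.totalDegree = d)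
    (hvan : ∀ x : (i : Fin m) → Fin (lam i) → ℂ, (∀ i, x i ∈ U i) →
      MvPolynomial.eval (fun q : (i : Fin m) × Fin (lam i) => x q.1 q.2) p = 0) :
    ∃ V : (i : Fin m) → Set (Fin (lam i) → ℂ),
      (∀ i, IsZariskiClosed (V i)) ∧ (∀ i, (V i).Infinite) ∧
      ∀ x : (i : Fin m) → Fin (lam i) → ℂ, (∀ i, x i ∈ V i) →
        MvPolynomial.eval (fun q : (i : Fin m) × Fin (lam i) => x q.1 q.2) p = 0 := by
  classical
  suffices h : ∀ s : Finset (Fin m), ∃ V : (i : Fin m) → Set (Fin (lam i) → ℂ),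
      (∀ i ∈ s, IsZariskiClosed (V i) ∧ (V i).Infinite) ∧ (∀ i ∉ s, V i = U i) ∧
      ∀ x : (i : Fin m) → Fin (lam i) → ℂ, (∀ i, x i ∈ V i) →
        MvPolynomial.eval (fun q : (i : Fin m) × Fin (lam i) => x q.1 q.2) p = 0 by
    obtain ⟨V, hV, -, hp⟩ := h Finset.univ
    exact ⟨V, fun i => (hV i (Finset.mem_univ i)).1, fun i => (hV i (Finset.mem_univ i)).2, hp⟩
  intro s
  induction s using Finset.induction_on with
  | empty => exact ⟨fun i => U i, by simp, by simp, by simpa using hvan⟩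
  | insert i s his ih =>
    obtain ⟨V, hV, hVU, hVp⟩ := ih
    let T : Set (MvPolynomial (Fin (lam i)) ℂ) :=
      {f | ∃ x : (j : Fin m) → Fin (lam j) → ℂ, (∀ j, j ≠ i → x j ∈ V j) ∧
        f = MvPolynomial.restrictBlock (τ := fun j => Fin (lam j)) i x p}
    have hinf := MvPolynomial.infinite_zeros_of_pow_lt_card T
      (by
        rintro _ ⟨x, -, rfl⟩
        exact hp ▸ MvPolynomial.totalDegree_restrictBlock_le (τ := fun j => Fin (lam j)) i x p)
      (U i) (hU i) (by
        rintro y hy _ ⟨x, hx, rfl⟩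
        rw [MvPolynomial.eval_restrictBlock (τ := fun j => Fin (lam j))]
        refine hVp _ fun j => ?_
        by_cases hj : j = i
        · subst hj
          simpa [hVU _ his] using hy
        · simpa [hj] using hx j hj)
    refine ⟨Function.update V i {y | ∀ f ∈ T, MvPolynomial.eval y f = 0}, ?_, ?_, ?_⟩
    · intro j hj
      by_cases hji : j = i
      · subst hji
        rw [Function.update_self]
        exact ⟨⟨T, rfl⟩, hinf⟩
      · rw [Function.update_of_ne hji]
        exact hV j ((Finset.mem_insert.1 hj).resolve_left hji)
    · intro j hj
      rw [Finset.mem_insert, not_or] at hj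
      rw [Function.update_of_ne hj.1]
      exact hVU j hj.2
    · intro x hx
      have hxi := hx i
      rw [Function.update_self] at hxi
      have := hxi _ ⟨x, fun j hj => by simpa [hj] using hx j, rfl⟩
      rwa [MvPolynomial.eval_restrictBlock (τ := fun j => Fin (lam j)), Function.update_eq_self] at this
end

section
/- Let F be a field, let S ⊂ F^k be a finite set with deg(S) > d, and let α ∈ ℤ_{≥0}^k be a multi-index with |α| ≤ d. Then there exists a function f : S → F such that Σ_{y ∈ S} f(y) y^β = 0 for every multi-index β ∈ ℤ_{≥0}^k with |β| ≤ d and β ≠ α, and Σ_{y ∈ S} f(y) y^α = 1. (Here y^β = y_1^{β_1}⋯y_k^{β_k}.) Equivalently, the multivariate Vandermonde matrix whose rows are indexed by multi-indices β with |β| ≤ d and whose columns are the evaluations (y^β)_{y ∈ S} has full row rank. -/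
/-- A linear functional on the functions on a finite set `S` is a weighted sum of evaluations
at the points of `S`. -/
theorem LinearMap.exists_weights_of_finset {R X : Type*} [CommSemiring R] (S : Finset X)
    (g : (S → R) →ₗ[R] R) :
    ∃ f : X → R, ∀ v : X → R, ∑ y ∈ S, f y * v y = g fun y => v y := by
  classical
  refine ⟨fun y => if h : y ∈ S then g (fun j => if ⟨y, h⟩ = j then 1 else 0) else 0,
    fun v => ?_⟩
  rw [LinearMap.pi_apply_eq_sum_univ g, ← Finset.sum_coe_sort S]
  exact Finset.sum_congr rfl fun y _ => by simp [mul_comm]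

/-- If no nonzero element of the vector space `V` is annihilated by all the functionals `e y` with
`y` in the finite set `S`, then every functional on `V` is a linear combination of these. -/
theorem LinearMap.exists_weights_of_separating {F V X : Type*} [Field F] [AddCommGroup V]
    [Module F V] (S : Finset X) (e : X → V →ₗ[F] F)
    (hS : ∀ q : V, q ≠ 0 → ∃ y ∈ S, e y q ≠ 0) (φ : V →ₗ[F] F) :
    ∃ f : X → F, ∀ q : V, ∑ y ∈ S, f y * e y q = φ q := by
  let E : V →ₗ[F] (S → F) := LinearMap.pi fun y => e y
  have hker : LinearMap.ker E = ⊥ := by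
    refine (Submodule.eq_bot_iff _).2 fun q hq => ?_
    by_contra h
    obtain ⟨y, hy, hne⟩ := hS q h
    exact hne (congrFun (LinearMap.mem_ker.1 hq) ⟨y, hy⟩)
  obtain ⟨L, hL⟩ := E.exists_leftInverse_of_injective hker
  obtain ⟨f, hf⟩ := LinearMap.exists_weights_of_finset S (φ ∘ₗ L)
  exact ⟨f, fun q => (hf fun y => e y q).trans (congrArg φ (LinearMap.congr_fun hL q))⟩

/-- **Dual interpolation functions on a set of large algebraic degree.**
The hypothesis `hS` says that `deg(S) > d`: no nonzero polynomial of total degree at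
most `d` vanishes on all of `S`. -/
theorem stmt_14 {F : Type*} [Field F] (k d : ℕ) (S : Finset (Fin k → F))
    (hS : ∀ q : MvPolynomial (Fin k) F, q ≠ 0 → q.totalDegree ≤ d →
      ∃ y ∈ S, MvPolynomial.eval y q ≠ 0)
    (α : Fin k → ℕ) (hα : (∑ j, α j) ≤ d) :
    ∃ f : (Fin k → F) → F,
      ∀ β : Fin k → ℕ, (∑ j, β j) ≤ d →
        (∑ y ∈ S, f y * ∏ j, y j ^ β j) = if β = α then 1 else 0 := by
  classical
  let V := MvPolynomial.restrictTotalDegree (Fin k) F d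
  obtain ⟨f, hf⟩ := LinearMap.exists_weights_of_separating S
    (fun y => (MvPolynomial.aeval y).toLinearMap ∘ₗ V.subtype)
    (fun q h0 => hS q (fun h => h0 (Subtype.ext h))
      ((MvPolynomial.mem_restrictTotalDegree _ _ _).1 q.2))
    (MvPolynomial.lcoeff F (Finsupp.equivFunOnFinite.symm α) ∘ₗ V.subtype)
  refine ⟨f, fun β hβ => ?_⟩
  have hmem : MvPolynomial.monomial (Finsupp.equivFunOnFinite.symm β) (1 : F) ∈ V := by
    rw [MvPolynomial.mem_restrictTotalDegree, MvPolynomial.totalDegree_monomial _ one_ne_zero,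
      Finsupp.sum_fintype _ _ fun _ => rfl]
    simpa using hβ
  simpa [MvPolynomial.eval_monomial, Finsupp.prod_fintype, MvPolynomial.coeff_monomial] using
    hf ⟨_, hmem⟩
end

section
/- The polynomial p(x_1,x_2,x_3,x_4) = x_1 + x_2 x_3 + x_4 ∈ ℂ[x_1,x_2,x_3,x_4] is (2,2)-irreducible: there do not exist infinite Zariski closed sets V_1 ⊆ ℂ² (in the variables x_1,x_2) and V_2 ⊆ ℂ² (in the variables x_3,x_4) such that p vanishes on every point of V_1 × V_2. -/
/-- The polynomial `p(x₁,x₂,x₃,x₄) = x₁ + x₂x₃ + x₄` is `(2,2)`-irreducible: there are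
no infinite Zariski closed sets `V₁, V₂ ⊆ ℂ²` with `V₁ × V₂` contained in its zero set. -/
theorem stmt_15 :
    ¬ ∃ V₁ V₂ : Set (ℂ × ℂ),
      (∃ T : Set (MvPolynomial (Fin 2) ℂ),
        V₁ = {z : ℂ × ℂ | ∀ f ∈ T, MvPolynomial.eval ![z.1, z.2] f = 0}) ∧
      (∃ T : Set (MvPolynomial (Fin 2) ℂ),
        V₂ = {z : ℂ × ℂ | ∀ f ∈ T, MvPolynomial.eval ![z.1, z.2] f = 0}) ∧
      V₁.Infinite ∧ V₂.Infinite ∧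
      ∀ z₁ ∈ V₁, ∀ z₂ ∈ V₂, z₁.1 + z₁.2 * z₂.1 + z₂.2 = 0 := by
  rintro ⟨V₁, V₂, -, -, h₁, h₂, h⟩
  obtain ⟨⟨a, b⟩, hp, ⟨c, d⟩, hq, hpq⟩ := h₁.nontrivial
  obtain ⟨⟨s, t⟩, hu, ⟨v, w⟩, hv, huv⟩ := h₂.nontrivial
  have e₁ := h _ hp _ hu
  have e₂ := h _ hp _ hv
  have e₃ := h _ hq _ hu
  have e₄ := h _ hq _ hv
  simp only at e₁ e₂ e₃ e₄
  have key : (b - d) * (s - v) = 0 := by linear_combination e₁ - e₂ - e₃ + e₄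
  rcases mul_eq_zero.mp key with hbd | hsv
  · obtain rfl := sub_eq_zero.mp hbd
    exact hpq (Prod.ext (by linear_combination e₁ - e₃) rfl)
  · obtain rfl := sub_eq_zero.mp hsv
    exact huv (Prod.ext rfl (by linear_combination e₁ - e₂))
end
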